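/- With the fused crystal model, the bijection ι_Θ and the Berenstein–Kirillov involution t_{r−i} of the context: let Θ ∈ {Γ,Δ}^r with Θ_i ≠ Θ_{i+1} for some 1 ≤ i ≤ r−1, let 𝔰 ∈ 𝔖^Θ_{λ+ρ} be an admissible state and let 𝔰' ∈ 𝔖^{s_iΘ}_{λ+ρ} be the unique admissible state with ι_{s_iΘ}(𝔰') = t_{r−i}(ι_Θ(𝔰)). For any admissible state 𝔱 of row types Φ ∈ {Γ,Δ}^r, let σ(𝔱) ∈ {0,1,…,m}^r record, for each row t, the spin of the horizontal boundary edge of row t on its exit side (the right boundary edge if Φ_t = Γ, the left boundary edge if Φ_t = Δ). Then σ(𝔰') = s_i σ(𝔰), i.e. the exit boundary colors of 𝔰' are those of 𝔰 with entries i and i+1 interchanged. -/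

import Mathlib

namespace Crystal

/-- Row types of the fused crystal model: `Γ` (right-moving) and `Δ` (left-moving). -/
inductive GD | G | D
deriving DecidableEq

/-- A state of the fused crystal grid with `r` rows and `N` columns: spins in `{0,1,…,m}`
on all horizontal and vertical edges. -/
structure CState (m r N : ℕ) where
  hor : Fin r → Fin (N + 1) → Fin (m + 1)
  ver : Fin (r + 1) → Fin N → Fin (m + 1)

/-- The Γ-weight of a configuration `(left, top, right, bottom) = (a,b,c,d)` with row
parameter `z`. -/
noncomputable def wtG {K : Type*} [Field K] (z : K) (a b c d : ℕ) : K :=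
  if a = 0 ∧ b = 0 ∧ c = 0 ∧ d = 0 then 1
  else if a ≠ 0 ∧ b ≠ 0 ∧ c = a ∧ d = b then (if a = b then z else if b < a then 1 else 0)
  else if a ≠ 0 ∧ b ≠ 0 ∧ a ≠ b ∧ c = b ∧ d = a then (if a < b then z else 0)
  else if a = 0 ∧ b ≠ 0 ∧ c = 0 ∧ d = b then 0
  else if a ≠ 0 ∧ b = 0 ∧ c = a ∧ d = 0 then z
  else if a ≠ 0 ∧ b = 0 ∧ c = 0 ∧ d = a then z
  else if a = 0 ∧ b ≠ 0 ∧ c = b ∧ d = 0 then 1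
  else 0

/-- The Δ-weight of a configuration `(left, top, right, bottom) = (a,b,c,d)` with row
parameter `z`. -/
noncomputable def wtD {K : Type*} [Field K] (z : K) (a b c d : ℕ) : K :=
  if a = 0 ∧ b = 0 ∧ c = 0 ∧ d = 0 then z
  else if a ≠ 0 ∧ b ≠ 0 ∧ c = a ∧ d = b then (if a ≤ b then 1 else 0)
  else if a ≠ 0 ∧ b = a ∧ c ≠ 0 ∧ d = c ∧ c ≠ a then (if a < c then 1 else 0)
  else if a = 0 ∧ b ≠ 0 ∧ c = 0 ∧ d = b then 0
  else if a ≠ 0 ∧ b = 0 ∧ c = a ∧ d = 0 then 1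
  else if a = 0 ∧ b = 0 ∧ c ≠ 0 ∧ d = c then z
  else if a ≠ 0 ∧ b = a ∧ c = 0 ∧ d = 0 then 1
  else 0

/-- The weight of a vertex of row type `ty`. -/
noncomputable def wtVert {K : Type*} [Field K] (ty : GD) (z : K) (a b c d : ℕ) : K :=
  match ty with
  | .G => wtG z a b c d
  | .D => wtD z a b c d

/-- The column number of the column at position `p` from the left
(columns are numbered `N−1, …, 1, 0` from left to right). -/
def colNum (N : ℕ) (p : Fin N) : ℕ := N - 1 - (p : ℕ)

/-- The weight of the vertex of a state `s` at row `t` and column position `p`, with row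
types `Θ` and row parameters `z`. -/
noncomputable def vertexW {K : Type*} [Field K] (m r N : ℕ) (Θ : Fin r → GD)
    (z : Fin r → K) (s : CState m r N) (t : Fin r) (p : Fin N) : K :=
  wtVert (Θ t) (z t) (s.hor t p.castSucc : ℕ) (s.ver t.castSucc p : ℕ)
    (s.hor t p.succ : ℕ) (s.ver t.succ p : ℕ)

/-- The boundary conditions of the fused crystal system `𝔖^Θ_{λ+ρ}`: the vertical edges
above row `1` are unoccupied except the one in column `λ_t + r − t`, which carries color
`γ_t`; the vertical edges below row `r` are unoccupied; and for each row `t` the left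
(resp. right) boundary edge is unoccupied when `Θ_t = Γ` (resp. `Θ_t = Δ`). -/
def boundary (m r N : ℕ) (γ lam : Fin r → ℕ) (Θ : Fin r → GD) (s : CState m r N) : Prop :=
  (∀ p : Fin N, (∀ t : Fin r, colNum N p ≠ lam t + (r - 1 - (t : ℕ))) → s.ver 0 p = 0) ∧
  (∀ p : Fin N, ∀ t : Fin r, colNum N p = lam t + (r - 1 - (t : ℕ)) →
      (s.ver 0 p : ℕ) = γ t) ∧
  (∀ p : Fin N, s.ver (Fin.last r) p = 0) ∧
  (∀ t : Fin r, (Θ t = GD.G → s.hor t 0 = 0) ∧ (Θ t = GD.D → s.hor t (Fin.last N) = 0))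

/-- A state is admissible if every vertex of the grid has nonzero weight. -/
def admissible {K : Type*} [Field K] (m r N : ℕ) (Θ : Fin r → GD) (z : Fin r → K)
    (s : CState m r N) : Prop :=
  ∀ (t : Fin r) (p : Fin N), vertexW m r N Θ z s t p ≠ 0

/-- Membership in the system `𝔖^Θ_{λ+ρ}`. -/
def Sys {K : Type*} [Field K] (m r N : ℕ) (γ lam : Fin r → ℕ) (Θ : Fin r → GD)
    (z : Fin r → K) (s : CState m r N) : Prop :=
  boundary m r N γ lam Θ s ∧ admissible m r N Θ z s

/-- The Boltzmann weight of a state: the product over all vertices of their weights. -/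
noncomputable def wtState {K : Type*} [Field K] (m r N : ℕ) (Θ : Fin r → GD)
    (z : Fin r → K) (s : CState m r N) : K :=
  ∏ t : Fin r, ∏ p : Fin N, vertexW m r N Θ z s t p

/-- The set of column numbers of the occupied vertical edges at level `i` (level `0` is the
top boundary, level `i ≥ 1` is just below lattice row `i`). -/
def occSet (m r N : ℕ) (s : CState m r N) (i : Fin (r + 1)) : Finset ℕ :=
  (Finset.univ.filter fun p : Fin N => s.ver i p ≠ 0).image (colNum N)

/-- The triangular array `ι_Θ(𝔰)` associated to a state: row `i` lists, in decreasing
order, the column numbers of the occupied vertical edges at level `i`. -/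
noncomputable def iotaArr (m r N : ℕ) (s : CState m r N) : ℕ → ℕ → ℕ :=
  fun i j =>
    if h : i < r ∧ i ≤ j ∧ j < r then
      (((occSet m r N s ⟨i, by omega⟩).sort (· ≤ ·)).reverse.getD (j - i) 0)
    else 0

/-- A triangular array, encoded as a function `ℕ → ℕ → ℕ` vanishing outside the triangle,
is a Gelfand–Tsetlin pattern with `r` rows if the interlacing inequalities hold. -/
def IsGTP (r : ℕ) (a : ℕ → ℕ → ℕ) : Prop :=
  (∀ i j, (j < i ∨ r ≤ j) → a i j = 0) ∧
  (∀ i j, 1 ≤ i → i ≤ j → j < r → a (i - 1) (j - 1) ≥ a i j ∧ a i j ≥ a (i - 1) j)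

/-- The row-pair `(i−1, i)` is left-strict (type `Γ`). -/
def RowPairG (r : ℕ) (a : ℕ → ℕ → ℕ) (i : ℕ) : Prop :=
  ∀ j, i ≤ j → j < r → a (i - 1) (j - 1) > a i j ∧ a i j ≥ a (i - 1) j

/-- The row-pair `(i−1, i)` is right-strict (type `Δ`). -/
def RowPairD (r : ℕ) (a : ℕ → ℕ → ℕ) (i : ℕ) : Prop :=
  ∀ j, i ≤ j → j < r → a (i - 1) (j - 1) ≥ a i j ∧ a i j > a (i - 1) j

/-- Membership in `GTP^{Θ'}_μ`: a Gelfand–Tsetlin pattern with top row `μ` whose row-pair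
`(i−1, i)` has type `Θ'_i` for every `1 ≤ i ≤ r−1`; here `Θ' i = Θ_i` is the truncation
of the row types `Θ` (indexed `0`-based: `Θ'_i = Θ ⟨i−1⟩`). -/
def memGTPTyped (r : ℕ) (Θ : Fin r → GD) (μ : ℕ → ℕ) (a : ℕ → ℕ → ℕ) : Prop :=
  IsGTP r a ∧ (∀ j, j < r → a 0 j = μ j) ∧
  ∀ i, ∀ hi : 1 ≤ i ∧ i < r,
    ((Θ ⟨i - 1, by omega⟩ = GD.G → RowPairG r a i) ∧
     (Θ ⟨i - 1, by omega⟩ = GD.D → RowPairD r a i))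

/-- The top row `λ + ρ` (`0`-based: entry `j` is `λ_{j+1} + (r − 1 − j)`). -/
def topRow (r : ℕ) (lam : Fin r → ℕ) : ℕ → ℕ :=
  fun j => (if h : j < r then lam ⟨j, h⟩ else 0) + (r - 1 - j)

/-- The new value of the entry `a_{i,j}` under the Berenstein–Kirillov involution `t_{r−i}`
(which acts on row `i`), with the boundary omissions when `j = i` and `j = r−1`. -/
def bkEntry (r : ℕ) (a : ℕ → ℕ → ℕ) (i j : ℕ) : ℕ :=
  (if j = i then a (i - 1) (j - 1) else min (a (i - 1) (j - 1)) (a (i + 1) j)) +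
    (if j = r - 1 then a (i - 1) j else max (a (i - 1) j) (a (i + 1) (j + 1))) - a i j

/-- The Berenstein–Kirillov involution `t_{r−i}`, acting on row `i` of a triangular array
with `r` rows. -/
def bkMap (r i : ℕ) (a : ℕ → ℕ → ℕ) : ℕ → ℕ → ℕ :=
  fun i' j => if i' = i ∧ i ≤ j ∧ j < r then bkEntry r a i j else a i' j

/-- The exit boundary colors `σ(𝔱)`: for each row `t`, the spin of the horizontal boundary
edge of row `t` on its exit side (right for `Γ`, left for `Δ`). -/
def exitColor (m r N : ℕ) (Θ : Fin r → GD) (s : CState m r N) (t : Fin r) : ℕ :=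
  match Θ t with
  | GD.G => (s.hor t (Fin.last N) : ℕ)
  | GD.D => (s.hor t 0 : ℕ)

/-- The configurations `(left, top, right, bottom)` of nonzero Γ-weight: the carrier travels to
the right and keeps the larger color. -/
def VertG (a b c d : ℕ) : Prop :=
  (a = 0 ∧ b = 0 ∧ c = 0 ∧ d = 0) ∨ (a ≠ 0 ∧ b ≠ 0 ∧ c = max a b ∧ d = min a b) ∨
  (a ≠ 0 ∧ b = 0 ∧ c = a ∧ d = 0) ∨ (a ≠ 0 ∧ b = 0 ∧ c = 0 ∧ d = a) ∨
  (a = 0 ∧ b ≠ 0 ∧ c = b ∧ d = 0)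

/-- The configurations `(left, top, right, bottom)` of nonzero Δ-weight: the carrier travels to
the left and keeps the smaller color. -/
def VertD (a b c d : ℕ) : Prop :=
  (a = 0 ∧ b = 0 ∧ c = 0 ∧ d = 0) ∨ (c ≠ 0 ∧ b ≠ 0 ∧ a = min b c ∧ d = max b c) ∨
  (c ≠ 0 ∧ b = 0 ∧ a = c ∧ d = 0) ∨ (c ≠ 0 ∧ b = 0 ∧ a = 0 ∧ d = c) ∨
  (c = 0 ∧ b ≠ 0 ∧ a = b ∧ d = 0)

theorem vertG_of_wtG_ne_zero {K : Type*} [Field K] {z : K} {a b c d : ℕ}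
    (h : wtG z a b c d ≠ 0) : VertG a b c d := by
  unfold wtG at h
  unfold VertG
  split_ifs at h <;> first | exact absurd rfl h | omega

theorem vertD_of_wtD_ne_zero {K : Type*} [Field K] {z : K} {a b c d : ℕ}
    (h : wtD z a b c d ≠ 0) : VertD a b c d := by
  unfold wtD at h
  unfold VertD
  split_ifs at h <;> first | exact absurd rfl h | omega

/-- The number of occupied edges among the first `c` edges of `v`. -/
def occCount (v : ℕ → ℕ) (c : ℕ) : ℕ := ∑ p ∈ Finset.range c, min (v p) 1

theorem occCount_succ (v : ℕ → ℕ) (c : ℕ) :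
    occCount v (c + 1) = occCount v c + min (v c) 1 := Finset.sum_range_succ _ _

theorem occCount_mono (v : ℕ → ℕ) : Monotone (occCount v) :=
  monotone_nat_of_le_succ fun c => by rw [occCount_succ]; omega

theorem occCount_congr {v w : ℕ → ℕ} {N c : ℕ} (h : ∀ p < N, v p = 0 ↔ w p = 0)
    (hc : c ≤ N) : occCount v c = occCount w c :=
  Finset.sum_congr rfl fun p hp => by
    have := h p (by have := Finset.mem_range.1 hp; omega)
    omega

theorem eq_zero_iff_of_occCount_eq {v w : ℕ → ℕ} {N p : ℕ}
    (h : ∀ c ≤ N, occCount v c = occCount w c) (hp : p < N) : v p = 0 ↔ w p = 0 := by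
  have h1 := h p hp.le
  have h2 := h (p + 1) hp
  rw [occCount_succ, occCount_succ] at h2
  omega

/-- A row of type Γ with horizontal edges `h`, top edges `v` and bottom edges `w`. -/
def RowG (N : ℕ) (h v w : ℕ → ℕ) : Prop :=
  h 0 = 0 ∧ ∀ p < N, VertG (h p) (v p) (h (p + 1)) (w p)

/-- A row of type Δ with horizontal edges `h`, top edges `v` and bottom edges `w`. -/
def RowD (N : ℕ) (h v w : ℕ → ℕ) : Prop :=
  h N = 0 ∧ ∀ p < N, VertD (h p) (v p) (h (p + 1)) (w p)

theorem RowG.occCount_eq {N : ℕ} {h v w : ℕ → ℕ} (H : RowG N h v w) {c : ℕ} (hc : c ≤ N) :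
    occCount v c = occCount w c + min (h c) 1 := by
  induction c with
  | zero => simp [occCount, H.1]
  | succ c ih =>
    have h1 := ih (by omega)
    have h2 := H.2 c (by omega)
    unfold VertG at h2
    rw [occCount_succ, occCount_succ]
    omega

theorem RowD.occCount_eq {N : ℕ} {h v w : ℕ → ℕ} (H : RowD N h v w) {c : ℕ} (hc : c ≤ N) :
    occCount v c + min (h c) 1 = occCount w c + min (h 0) 1 := by
  induction c with
  | zero => simp [occCount]
  | succ c ih =>
    have h1 := ih (by omega)
    have h2 := H.2 c (by omega)
    unfold VertD at h2
    rw [occCount_succ, occCount_succ]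
    omega

/-- A Γ-row is determined by its top edges and the occupancy of its bottom edges. -/
theorem RowG.unique {N : ℕ} {h v w h' v' w' : ℕ → ℕ} (H : RowG N h v w) (H' : RowG N h' v' w')
    (hv : ∀ p < N, v p = v' p) (hw : ∀ p < N, w p = 0 ↔ w' p = 0) :
    (∀ p < N, w p = w' p) ∧ h N = h' N := by
  have step : ∀ p < N, h p = h' p → h (p + 1) = h' (p + 1) ∧ w p = w' p := by
    intro p hp e
    have h1 := H.2 p hp
    have h2 := H'.2 p hp
    have h3 := hv p hp
    have h4 := hw p hp
    unfold VertG at h1 h2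
    omega
  have key : ∀ p ≤ N, h p = h' p := by
    intro p
    induction p with
    | zero => intro _; rw [H.1, H'.1]
    | succ p ih => intro hp; exact (step p hp (ih (by omega))).1
  exact ⟨fun p hp => (step p hp (key p hp.le)).2, key N le_rfl⟩

/-- A Δ-row is determined by its top edges and the occupancy of its bottom edges. -/
theorem RowD.unique {N : ℕ} {h v w h' v' w' : ℕ → ℕ} (H : RowD N h v w) (H' : RowD N h' v' w')
    (hv : ∀ p < N, v p = v' p) (hw : ∀ p < N, w p = 0 ↔ w' p = 0) :
    (∀ p < N, w p = w' p) ∧ h 0 = h' 0 := by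
  have step : ∀ p < N, h (p + 1) = h' (p + 1) → h p = h' p ∧ w p = w' p := by
    intro p hp e
    have h1 := H.2 p hp
    have h2 := H'.2 p hp
    have h3 := hv p hp
    have h4 := hw p hp
    unfold VertD at h1 h2
    omega
  have key : ∀ p ≤ N, h p = h' p := fun p hp =>
    Nat.decreasingInduction' (P := fun p => h p = h' p)
      (fun q hq _ e => (step q hq e).1) hp (by rw [H.1, H'.1])
  exact ⟨fun p hp => (step p hp (key (p + 1) hp)).2, key 0 (Nat.zero_le N)⟩

/-- The relation, at a vertical cut, between the Γ-carrier `g` and the Δ-carrier `d` of a pair of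
rows of types `Γ, Δ` and the Δ-carrier `d'` of the corresponding pair of types `Δ, Γ`. The flag
`P` records that both pairs have two carriers all the way between the two neighboring columns
with an occupied outer edge. -/
def CutD (P : Prop) (g d d' : ℕ) : Prop :=
  ((g = 0 ↔ d = 0) → (P → d ≤ g ∧ g ≠ 0 ∧ (d < g → d' = d) ∧ (d = g → g ≤ d')) ∧
    (¬ P → g = d)) ∧
  (¬ (g = 0 ↔ d = 0) → d' = d)

/-- The relation satisfied by the Γ-carrier `g'` of the pair of types `Δ, Γ`; see `CutD`. -/
def CutG (P : Prop) (g d d' g' : ℕ) : Prop :=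
  ((g = 0 ↔ d = 0) → (P → (d < g → g' = g) ∧ (d = g → g' = d')) ∧ (¬ P → g' = d')) ∧
  (¬ (g = 0 ↔ d = 0) → g' = g)

theorem VertG.of_top_empty {a c d : ℕ} (h : VertG a 0 c d) :
    (c = a ∧ d = 0) ∨ (c = 0 ∧ d = a) := by unfold VertG at h; omega

theorem VertG.of_top {a b c d : ℕ} (h : VertG a b c d) (hb : b ≠ 0) :
    (a = 0 ∧ c = b ∧ d = 0) ∨ (a ≠ 0 ∧ c = max a b ∧ d = min a b) := by
  unfold VertG at h; omega

theorem VertG.of_bottom_empty {a b c : ℕ} (h : VertG a b c 0) :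
    (b = 0 ∧ c = a) ∨ (a = 0 ∧ c = b) := by unfold VertG at h; omega

theorem VertG.of_bottom {a b c d : ℕ} (h : VertG a b c d) (hd : d ≠ 0) :
    (b = 0 ∧ c = 0 ∧ d = a) ∨ (a ≠ 0 ∧ b ≠ 0 ∧ c = max a b ∧ d = min a b) := by
  unfold VertG at h; omega

theorem VertD.of_top_empty {a c d : ℕ} (h : VertD a 0 c d) :
    (a = c ∧ d = 0) ∨ (a = 0 ∧ d = c) := by unfold VertD at h; omega

theorem VertD.of_top {a b c d : ℕ} (h : VertD a b c d) (hb : b ≠ 0) :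
    (c = 0 ∧ a = b ∧ d = 0) ∨ (c ≠ 0 ∧ a = min b c ∧ d = max b c) := by
  unfold VertD at h; omega

theorem VertD.of_bottom_empty {a b c : ℕ} (h : VertD a b c 0) :
    (b = 0 ∧ a = c) ∨ (c = 0 ∧ a = b) := by unfold VertD at h; omega

theorem VertD.of_bottom {a b c d : ℕ} (h : VertD a b c d) (hd : d ≠ 0) :
    (b = 0 ∧ a = 0 ∧ d = c) ∨ (c ≠ 0 ∧ b ≠ 0 ∧ a = min b c ∧ d = max b c) := by
  unfold VertD at h; omega

/-- The carriers `g, d` and `g', d'` of two pairs of rows have the same net flux. -/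
def SameFlux (g d d' g' : ℕ) : Prop :=
  ((g = 0 ↔ d = 0) → (g' = 0 ↔ d' = 0)) ∧
    (¬ (g = 0 ↔ d = 0) → (g' = 0 ↔ g = 0) ∧ (d' = 0 ↔ d = 0))

theorem cut_step_of_empty {P : Prop} {g d d' g' g₂ d₂ d₂' g₂' e e' : ℕ}
    (hg : VertG g 0 g₂ e) (hd : VertD d e d₂ 0) (hd' : VertD d' 0 d₂' e')
    (hg' : VertG g' e' g₂' 0)
    (hF : SameFlux g d d' g') (hF₂ : SameFlux g₂ d₂ d₂' g₂')
    (hpos : (g = 0 ↔ d = 0) → P → d' ≠ 0) (h : CutD P g₂ d₂ d₂') :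
    CutD P g d d' ∧ (CutG P g d d' g' → CutG P g₂ d₂ d₂' g₂') := by
  unfold CutD at h
  unfold CutD CutG
  unfold SameFlux at hF hF₂
  by_cases hP : P <;> simp only [hP, true_imp_iff, false_imp_iff, not_true, not_false_iff,
    true_and, and_true] at *
  all_goals
    rcases hg.of_top_empty with hg | hg <;>
    rcases hd.of_bottom_empty with hd | hd <;>
    rcases hd'.of_top_empty with hd' | hd' <;>
    rcases hg'.of_bottom_empty with hg' | hg' <;>
    grind

theorem cut_step_of_bottom {g d d' g' g₂ d₂ d₂' g₂' e e' b b' : ℕ}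
    (hg : VertG g 0 g₂ e) (hd : VertD d e d₂ b) (hd' : VertD d' 0 d₂' e')
    (hg' : VertG g' e' g₂' b')
    (hF : SameFlux g d d' g') (hF₂ : SameFlux g₂ d₂ d₂' g₂')
    (hb : b ≠ 0) (hb' : b' ≠ 0) (h : CutD (d₂' ≠ 0) g₂ d₂ d₂') :
    CutD (g ≠ 0) g d d' ∧ (CutG (g ≠ 0) g d d' g' → CutG (d₂' ≠ 0) g₂ d₂ d₂' g₂' ∧ b = b') := by
  unfold CutD at h
  unfold CutD CutG
  unfold SameFlux at hF hF₂
  rcases hg.of_top_empty with hg | hg <;>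
  rcases hd.of_bottom hb with hd | hd <;>
  rcases hd'.of_top_empty with hd' | hd' <;>
  rcases hg'.of_bottom hb' with hg' | hg' <;>
  grind

theorem cut_step_of_top {g d d' g' g₂ d₂ d₂' g₂' e e' t : ℕ}
    (hg : VertG g t g₂ e) (hd : VertD d e d₂ 0) (hd' : VertD d' t d₂' e')
    (hg' : VertG g' e' g₂' 0)
    (hF : SameFlux g d d' g') (hF₂ : SameFlux g₂ d₂ d₂' g₂')
    (ht : t ≠ 0) (h : CutD (d₂' ≠ 0) g₂ d₂ d₂') :
    CutD (g ≠ 0) g d d' ∧ (CutG (g ≠ 0) g d d' g' → CutG (d₂' ≠ 0) g₂ d₂ d₂' g₂') := by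
  unfold CutD at h
  unfold CutD CutG
  unfold SameFlux at hF hF₂
  rcases hg.of_top ht with hg | hg <;>
  rcases hd.of_bottom_empty with hd | hd <;>
  rcases hd'.of_top ht with hd' | hd' <;>
  rcases hg'.of_bottom_empty with hg' | hg' <;>
  grind

theorem cut_step_of_top_bottom {g d d' g' g₂ d₂ d₂' g₂' e e' t b b' : ℕ}
    (hg : VertG g t g₂ e) (hd : VertD d e d₂ b) (hd' : VertD d' t d₂' e')
    (hg' : VertG g' e' g₂' b')
    (hF : SameFlux g d d' g') (hF₂ : SameFlux g₂ d₂ d₂' g₂')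
    (ht : t ≠ 0) (hb : b ≠ 0) (hb' : b' ≠ 0) (h : CutD (d₂' ≠ 0) g₂ d₂ d₂') :
    CutD (g ≠ 0) g d d' ∧ (CutG (g ≠ 0) g d d' g' → CutG (d₂' ≠ 0) g₂ d₂ d₂' g₂' ∧ b = b') := by
  unfold CutD at h
  unfold CutD CutG
  unfold SameFlux at hF hF₂
  rcases hg.of_top ht with hg | hg <;>
  rcases hd.of_bottom hb with hd | hd <;>
  rcases hd'.of_top ht with hd' | hd' <;>
  rcases hg'.of_bottom hb' with hg' | hg' <;>
  grind (splits := 30)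

/-- The outer edges at position `u` of a pair of rows with top edges `t` and bottom edges `b` are
unoccupied. -/
def OuterEmpty (t b : ℕ → ℕ) (u : ℕ) : Prop := t u = 0 ∧ b u = 0

/-- The first column from position `c` on with an occupied outer edge has a Γ-carrier on its
left. -/
def NextCarrier (N : ℕ) (t b g : ℕ → ℕ) (c : ℕ) : Prop :=
  ∃ v, c ≤ v ∧ v < N ∧ ¬ OuterEmpty t b v ∧ (∀ w, c ≤ w → w < v → OuterEmpty t b w) ∧ g v ≠ 0

theorem nextCarrier_of_outerEmpty {N : ℕ} {t b g : ℕ → ℕ} {p : ℕ} (h : OuterEmpty t b p) :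
    NextCarrier N t b g p ↔ NextCarrier N t b g (p + 1) := by
  constructor
  · rintro ⟨v, h1, h2, h3, h4, h5⟩
    have : p ≠ v := fun e => h3 (e ▸ h)
    exact ⟨v, by omega, h2, h3, fun w hw => h4 w (by omega), h5⟩
  · rintro ⟨v, h1, h2, h3, h4, h5⟩
    refine ⟨v, by omega, h2, h3, fun w hw hwv => ?_, h5⟩
    rcases hw.eq_or_lt with rfl | hw
    · exact h
    · exact h4 w hw hwv

theorem nextCarrier_of_not_outerEmpty {N : ℕ} {t b g : ℕ → ℕ} {p : ℕ} (hp : p < N)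
    (h : ¬ OuterEmpty t b p) : NextCarrier N t b g p ↔ g p ≠ 0 := by
  constructor
  · rintro ⟨v, h1, h2, h3, h4, h5⟩
    rcases h1.eq_or_lt with rfl | h1
    · exact h5
    · exact absurd (h4 p le_rfl h1) h
  · exact fun hg => ⟨p, le_rfl, hp, h, fun w h1 h2 => by omega, hg⟩

/-- The compatibility of two pairs of rows prescribed by a Berenstein–Kirillov involution:
between two successive columns `u < v` with an occupied outer edge, the pair of types `Δ, Γ` has a
Δ-carrier to the right of `u` exactly if the pair of types `Γ, Δ` has a Γ-carrier to the left
of `v`. -/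
def Reflected (N : ℕ) (t b g d d' : ℕ → ℕ) : Prop :=
  ∀ u v, u < v → v < N → ¬ OuterEmpty t b u → ¬ OuterEmpty t b v →
    (∀ w, u < w → w < v → OuterEmpty t b w) → (g (u + 1) = 0 ↔ d (u + 1) = 0) →
    (d' (u + 1) ≠ 0 ↔ g v ≠ 0)

/-- Exchanging the types of two neighboring rows of different types by a Berenstein–Kirillov
involution preserves the bottom colors and the exit color of each row type. -/
theorem exchange_rows {N : ℕ} {t e e' b b' g d d' g' : ℕ → ℕ} (hg : RowG N g t e)
    (hd : RowD N d e b) (hd' : RowD N d' t e') (hg' : RowG N g' e' b') (hd0 : d 0 ≠ 0)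
    (hd0' : d' 0 ≠ 0) (hgN : g N ≠ 0) (hb : ∀ p < N, b p = 0 ↔ b' p = 0)
    (hR : Reflected N t b g d d') :
    d 0 = d' 0 ∧ g N = g' N ∧ ∀ p < N, b p = b' p := by
  have hflux : ∀ p ≤ N, SameFlux (g p) (d p) (d' p) (g' p) := by
    intro p hp
    have h1 := hg.occCount_eq hp
    have h2 := hd.occCount_eq hp
    have h3 := hd'.occCount_eq hp
    have h4 := hg'.occCount_eq hp
    have h5 := occCount_congr hb hp
    unfold SameFlux
    omega
  set P := NextCarrier N t b g with hP
  have hright : ∀ p < N, ¬ OuterEmpty t b p → (g (p + 1) = 0 ↔ d (p + 1) = 0) →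
      (P (p + 1) ↔ d' (p + 1) ≠ 0) := by
    intro p hp hne hf
    have hex : ∃ v, p < v ∧ v < N ∧ ¬ OuterEmpty t b v := by
      by_contra! hcon
      have key : ∀ q, p + 1 ≤ q → q ≤ N → (g q = 0 ↔ d q = 0) := by
        intro q hq
        induction q, hq using Nat.le_induction with
        | base => exact fun _ => hf
        | succ q hq ih =>
          intro hqN
          have h1 := ih (by omega)
          have h2 := hcon q (by omega) (by omega)
          have h3 := hg.2 q (by omega)
          have h4 := hd.2 q (by omega)
          unfold OuterEmpty at h2
          unfold VertG at h3
          unfold VertD at h4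
          omega
      exact hgN ((key N hp le_rfl).2 hd.1)
    classical
    obtain ⟨h1, h2, h3⟩ := Nat.find_spec hex
    have h4 : ∀ w, p < w → w < Nat.find hex → OuterEmpty t b w := by
      intro w hw hwv
      have := Nat.find_min hex hwv
      by_contra hcon
      exact this ⟨hw, by omega, hcon⟩
    rw [hR p _ h1 h2 hne h3 h4 hf, hP]
    constructor
    · rintro ⟨v, h5, h6, h7, h8, h9⟩
      have h10 : Nat.find hex ≤ v := Nat.find_min' hex ⟨h5, h6, h7⟩
      rcases h10.eq_or_lt with e | h10
      · rwa [e]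
      · exact absurd (h8 _ h1 h10) h3
    · exact fun h => ⟨_, h1, h2, h3, fun w hw => h4 w hw, h⟩
  have hpos : ∀ p ≤ N, (g p = 0 ↔ d p = 0) → P p → d' p ≠ 0 := by
    intro p
    induction p with
    | zero => intro _ h; exact absurd (h.1 hg.1) hd0
    | succ p ih =>
      intro hp hf hPp
      by_cases hne : OuterEmpty t b p
      · have h3 := hg.2 p (by omega)
        have h4 := hd.2 p (by omega)
        have h5 := hd'.2 p (by omega)
        have h6 := ih (by omega)
        rw [hP, nextCarrier_of_outerEmpty hne, ← hP] at h6
        have hf' : g p = 0 ↔ d p = 0 := by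
          unfold OuterEmpty at hne
          unfold VertG at h3
          unfold VertD at h4
          omega
        have h7 := h6 hf' hPp
        rw [hne.1] at h5
        rcases h5.of_top_empty with h | h <;> omega
      · exact (hright p hp hne hf).1 hPp
  have step : ∀ p < N, CutD (P (p + 1)) (g (p + 1)) (d (p + 1)) (d' (p + 1)) →
      CutD (P p) (g p) (d p) (d' p) ∧ (CutG (P p) (g p) (d p) (d' p) (g' p) →
        CutG (P (p + 1)) (g (p + 1)) (d (p + 1)) (d' (p + 1)) (g' (p + 1)) ∧ b p = b' p) := by
    intro p hp h
    have h1 := hg.2 p hp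
    have h2 := hd.2 p hp
    have h3 := hd'.2 p hp
    have h4 := hg'.2 p hp
    have h5 := hflux p hp.le
    have h6 := hflux (p + 1) hp
    have h7 := hb p hp
    by_cases hne : OuterEmpty t b p
    · have hpp : P (p + 1) = P p := propext (nextCarrier_of_outerEmpty hne).symm
      rw [hpp] at h ⊢
      obtain ⟨ht, hbp⟩ := hne
      have hbp' := h7.1 hbp
      rw [ht] at h1 h3
      rw [hbp] at h2 ⊢
      rw [hbp'] at h4 ⊢
      exact (cut_step_of_empty h1 h2 h3 h4 h5 h6 (hpos p hp.le) h).imp_right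
        fun hG h => ⟨hG h, rfl⟩
    · have hpl : P p = (g p ≠ 0) := propext (nextCarrier_of_not_outerEmpty hp hne)
      have hpr : (g (p + 1) = 0 ↔ d (p + 1) = 0) → P (p + 1) = (d' (p + 1) ≠ 0) :=
        fun hf => propext (hright p hp hne hf)
      have hD : CutD (P (p + 1)) (g (p + 1)) (d (p + 1)) (d' (p + 1)) ↔
          CutD (d' (p + 1) ≠ 0) (g (p + 1)) (d (p + 1)) (d' (p + 1)) := by
        unfold CutD
        by_cases hf : g (p + 1) = 0 ↔ d (p + 1) = 0
        · rw [hpr hf]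
        · simp only [hf, false_imp_iff]
      have hG : CutG (P (p + 1)) (g (p + 1)) (d (p + 1)) (d' (p + 1)) (g' (p + 1)) ↔
          CutG (d' (p + 1) ≠ 0) (g (p + 1)) (d (p + 1)) (d' (p + 1)) (g' (p + 1)) := by
        unfold CutG
        by_cases hf : g (p + 1) = 0 ↔ d (p + 1) = 0
        · rw [hpr hf]
        · simp only [hf, false_imp_iff]
      rw [hD] at h
      rw [hG, hpl]
      by_cases ht : t p = 0 <;> by_cases hbp : b p = 0
      · exact absurd ⟨ht, hbp⟩ hne
      · rw [ht] at h1 h3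
        exact cut_step_of_bottom h1 h2 h3 h4 h5 h6 hbp (mt h7.2 hbp) h
      · have hbp' := h7.1 hbp
        rw [hbp] at h2 ⊢
        rw [hbp'] at h4 ⊢
        exact (cut_step_of_top h1 h2 h3 h4 h5 h6 ht h).imp_right fun hG h => ⟨hG h, rfl⟩
      · exact cut_step_of_top_bottom h1 h2 h3 h4 h5 h6 ht hbp (mt h7.2 hbp) h
  have cutD : ∀ p ≤ N, CutD (P p) (g p) (d p) (d' p) := fun p hp =>
    Nat.decreasingInduction' (P := fun p => CutD (P p) (g p) (d p) (d' p))
      (fun q hq _ h => (step q hq h).1) hp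
      ⟨fun h => absurd (h.2 hd.1) hgN, fun _ => by rw [hd.1, hd'.1]⟩
  have hd0eq : d' 0 = d 0 := (cutD 0 (Nat.zero_le N)).2 fun h => hd0 (h.1 hg.1)
  have cutG : ∀ p ≤ N, CutG (P p) (g p) (d p) (d' p) (g' p) := by
    intro p
    induction p with
    | zero =>
      exact fun _ => ⟨fun h => absurd (h.1 hg.1) hd0, fun _ => by rw [hg.1, hg'.1]⟩
    | succ p ih => exact fun hp => ((step p hp (cutD _ hp)).2 (ih (by omega))).1
  exact ⟨hd0eq.symm, ((cutG N le_rfl).2 fun h => hgN (h.2 hd.1)).symm,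
    fun p hp => ((step p hp (cutD _ hp)).2 (cutG p hp.le)).2⟩

theorem occCount_eq_of_unoccupied {v : ℕ → ℕ} {a b : ℕ} (hab : a ≤ b)
    (h : ∀ w, a ≤ w → w < b → v w = 0) : occCount v b = occCount v a := by
  induction b, hab using Nat.le_induction with
  | base => rfl
  | succ b hb ih =>
    rw [occCount_succ, ih fun w h1 h2 => h w h1 (by omega), h b hb (by omega)]
    simp

/-- The function `x` lists, in decreasing order, the column numbers of the `n` occupied edges
of `v`, where the edge at position `p` lies in column `N - 1 - p`. -/
def Lists (N n : ℕ) (v x : ℕ → ℕ) : Prop :=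
  ∀ q < n, ∀ c ≤ N, N - c ≤ x q ↔ q < occCount v c

/-- The sum of an entry with number `q` in a row of length `n` of a triangular array and its image
under the Berenstein–Kirillov involution, where `x` is the row above and `w` the row below. -/
def bkSum (n : ℕ) (x w : ℕ → ℕ) (q : ℕ) : ℕ :=
  (if q = 0 then x 0 else min (x q) (w (q - 1))) +
    (if q = n - 1 then x (q + 1) else max (x (q + 1)) (w q))

theorem reflected_of_bkSum {N n : ℕ} {t e e' b b' g d d' g' x a a' w : ℕ → ℕ} (hn : 1 ≤ n)
    (hg : RowG N g t e) (hd : RowD N d e b) (hd' : RowD N d' t e') (hg' : RowG N g' e' b')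
    (hd0 : d 0 ≠ 0) (hd0' : d' 0 ≠ 0) (hb : ∀ p < N, b p = 0 ↔ b' p = 0)
    (hbN : occCount b N = n - 1)
    (hx : Lists N (n + 1) t x) (ha : Lists N n e a) (ha' : Lists N n e' a')
    (hw : Lists N (n - 1) b w)
    (hbk : ∀ q < n, a' q = bkSum n x w q - a q ∨ a q = bkSum n x w q - a' q) :
    Reflected N t b g d d' := by
  intro u v huv hv hu hv' hbetween hflux
  have htv : occCount t v = occCount t (u + 1) :=
    occCount_eq_of_unoccupied huv fun w h1 h2 => (hbetween w h1 h2).1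
  have hbv : occCount b v = occCount b (u + 1) :=
    occCount_eq_of_unoccupied huv fun w h1 h2 => (hbetween w h1 h2).2
  have interlace : ∀ c ≤ N, occCount t c = occCount e c + min (g c) 1 ∧
      occCount e c + min (d c) 1 = occCount b c + 1 ∧
      occCount t c + min (d' c) 1 = occCount e' c + 1 ∧
      occCount e' c = occCount b c + min (g' c) 1 := fun c hc => by
    have h1 := hg.occCount_eq hc
    have h2 := hd.occCount_eq hc
    have h3 := hd'.occCount_eq hc
    have h4 := hg'.occCount_eq hc
    have h5 := occCount_congr hb hc
    omega
  obtain ⟨q, hq⟩ : ∃ q, q = occCount b (u + 1) := ⟨_, rfl⟩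
  have hqn : q < n := by
    have := occCount_mono b (show u + 1 ≤ N by omega)
    omega
  have hqt : occCount t (u + 1) = q + 1 := by
    have := interlace (u + 1) (by omega)
    omega
  rw [← hq] at hbv
  rw [hqt] at htv
  have hout : occCount t u + occCount b u < 2 * q + 1 := by
    have h1 := occCount_succ t u
    have h2 := occCount_succ b u
    unfold OuterEmpty at hu
    omega
  have hout' : 2 * q + 1 < occCount t (v + 1) + occCount b (v + 1) := by
    have h1 := occCount_succ t v
    have h2 := occCount_succ b v
    unfold OuterEmpty at hv'
    omega
  have htu : occCount t u = q ∨ occCount t u = q + 1 := by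
    have h1 := occCount_succ t u
    omega
  have hbu : occCount b u ≤ q := by
    have h1 := occCount_mono b u.le_succ
    omega
  have htv2 : occCount t (v + 1) = q + 1 ∨ occCount t (v + 1) = q + 2 := by
    have h1 := occCount_succ t v
    omega
  have hbv2 : q ≤ occCount b (v + 1) := by
    have h1 := occCount_mono b v.le_succ
    omega
  have hupper : (if q = 0 then x 0 else min (x q) (w (q - 1))) = N - (u + 1) := by
    have x1 := hx q (by omega) (u + 1) (by omega)
    have x2 := hx q (by omega) u (by omega)
    split_ifs with h0
    · subst h0
      omega
    · have w1 := hw (q - 1) (by omega) (u + 1) (by omega)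
      have w2 := hw (q - 1) (by omega) u (by omega)
      omega
  have hlower : (if q = n - 1 then x (q + 1) else max (x (q + 1)) (w q)) = N - (v + 1) := by
    have x3 := hx (q + 1) (by omega) v (by omega)
    have x4 := hx (q + 1) (by omega) (v + 1) (by omega)
    split_ifs with h0
    · have := occCount_mono b (show v + 1 ≤ N by omega)
      omega
    · have w1 := hw q (by omega) v (by omega)
      have w2 := hw q (by omega) (v + 1) (by omega)
      omega
  have hsum := hbk q hqn
  unfold bkSum at hsum
  rw [hupper, hlower] at hsum
  have hau : a q ≤ N - (u + 1) := by
    have h1 := ha q hqn u (by omega)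
    have h2 := interlace u (by omega)
    omega
  have hau' : a' q ≤ N - (u + 1) := by
    have h1 := ha' q hqn u (by omega)
    have h2 := interlace u (by omega)
    omega
  have hav : N - (v + 1) ≤ a q := by
    have h1 := ha q hqn (v + 1) (by omega)
    have h2 := interlace (v + 1) (by omega)
    omega
  have hav' : N - (v + 1) ≤ a' q := by
    have h1 := ha' q hqn (v + 1) (by omega)
    have h2 := interlace (v + 1) (by omega)
    omega
  have hleft : d' (u + 1) ≠ 0 ↔ a' q = N - (u + 1) := by
    have h1 := ha' q hqn (u + 1) (by omega)
    have h2 := interlace (u + 1) (by omega)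
    omega
  have hright : g v ≠ 0 ↔ a q = N - (v + 1) := by
    have h1 := ha q hqn v (by omega)
    have h2 := interlace v (by omega)
    omega
  rw [hleft, hright]
  omega

theorem le_getD_iff_lt_countP {l : List ℕ} (hl : l.Pairwise (· > ·)) (c : ℕ) {j : ℕ}
    (hj : j < l.length) : c ≤ l.getD j 0 ↔ j < l.countP (fun x => decide (c ≤ x)) := by
  induction l generalizing j with
  | nil => simp at hj
  | cons y l ih =>
    obtain ⟨hy, hl⟩ := List.pairwise_cons.1 hl
    rw [List.countP_cons]
    by_cases hc : c ≤ y
    · cases j with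
      | zero => simp [hc]
      | succ j =>
        have := ih hl (j := j) (by simpa using hj)
        simp only [List.getD_cons_succ, this, hc]
        simp
    · have h0 : l.countP (fun x => decide (c ≤ x)) = 0 :=
        List.countP_eq_zero.2 fun x hx => by have := hy x hx; simp; omega
      cases j with
      | zero => simp [hc, h0]
      | succ j =>
        have := ih hl (j := j) (by simpa using hj)
        simp only [List.getD_cons_succ, this, h0, hc]
        simp

theorem le_getD_reverse_sort_iff (S : Finset ℕ) (c : ℕ) {j : ℕ} (hj : j < S.card) :
    c ≤ (S.sort (· ≤ ·)).reverse.getD j 0 ↔ j < (S.filter (c ≤ ·)).card := by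
  have hl : (S.sort (· ≤ ·)).reverse.Pairwise (· > ·) :=
    List.pairwise_reverse.2 (Finset.sortedLT_sort S).pairwise
  rw [le_getD_iff_lt_countP hl c (by simpa using hj), List.countP_reverse]
  have : (S.sort (· ≤ ·)).countP (fun x => decide (c ≤ x)) = (S.filter (c ≤ ·)).card := by
    rw [Finset.card_def, Finset.filter_val, ← Multiset.countP_eq_card_filter,
      ← Multiset.coe_countP, Finset.sort_eq]
  rw [this]

/-- The horizontal spins of row `t`, indexed by natural numbers. -/
def horN {m r N : ℕ} (s : CState m r N) (t p : ℕ) : ℕ :=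
  if h : t < r ∧ p < N + 1 then s.hor ⟨t, h.1⟩ ⟨p, h.2⟩ else 0

/-- The vertical spins at level `l`, indexed by natural numbers. -/
def verN {m r N : ℕ} (s : CState m r N) (l p : ℕ) : ℕ :=
  if h : l < r + 1 ∧ p < N then s.ver ⟨l, h.1⟩ ⟨p, h.2⟩ else 0

theorem colNum_injective (N : ℕ) : Function.Injective (colNum N) := fun p q h => by
  unfold colNum at h
  omega

theorem card_filter_occSet {m r N : ℕ} (s : CState m r N) {l : ℕ} (hl : l < r + 1) {c : ℕ}
    (hc : c ≤ N) :
    ((occSet m r N s ⟨l, hl⟩).filter (N - c ≤ ·)).card = occCount (verN s l) c := by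
  unfold occSet
  rw [Finset.filter_image, Finset.card_image_of_injective _ (colNum_injective N),
    Finset.filter_filter, Finset.card_filter]
  have h1 : ∀ p : Fin N, (if s.ver ⟨l, hl⟩ p ≠ 0 ∧ N - c ≤ colNum N p then 1 else 0) =
      (fun p : ℕ => if p < c then min (verN s l p) 1 else 0) p := by
    intro p
    have hv : verN s l p = (s.ver ⟨l, hl⟩ p : ℕ) := by simp [verN, hl]
    have h0 : s.ver ⟨l, hl⟩ p = 0 ↔ (s.ver ⟨l, hl⟩ p : ℕ) = 0 := by
      rw [Fin.ext_iff]; rfl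
    have hp : N - c ≤ colNum N p ↔ (p : ℕ) < c := by unfold colNum; omega
    simp only [hv, ne_eq, h0, hp]
    split_ifs <;> omega
  rw [Finset.sum_congr rfl fun p _ => h1 p,
    Fin.sum_univ_eq_sum_range (fun p : ℕ => if p < c then min (verN s l p) 1 else 0) N,
    ← Finset.sum_filter, occCount]
  congr 1
  ext p
  simp
  omega

theorem lists_iotaArr {m r N : ℕ} {s : CState m r N} {l : ℕ} (hl : l < r)
    (h : occCount (verN s l) N = r - l) :
    Lists N (r - l) (verN s l) (fun q => iotaArr m r N s l (l + q)) := by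
  intro q hq c hc
  have hcard : (occSet m r N s ⟨l, by omega⟩).card = r - l := by
    have := card_filter_occSet s (l := l) (by omega) le_rfl
    simpa [h] using this
  have hlq : l < r ∧ l ≤ l + q ∧ l + q < r := by omega
  simp only [iotaArr, dif_pos hlq]
  rw [le_getD_reverse_sort_iff _ _ (by omega), card_filter_occSet s (by omega) hc]
  simp

/-- A row of type `ty`. -/
def TypedRow (ty : GD) (N : ℕ) (h v w : ℕ → ℕ) : Prop :=
  match ty with
  | .G => RowG N h v w
  | .D => RowD N h v w

/-- The spin on the exit side of a row of type `ty` with horizontal edges `h`. -/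
def rowExit (ty : GD) (N : ℕ) (h : ℕ → ℕ) : ℕ :=
  match ty with
  | .G => h N
  | .D => h 0

theorem TypedRow.occCount_eq {ty : GD} {N : ℕ} {h v w : ℕ → ℕ} (H : TypedRow ty N h v w) :
    occCount v N = occCount w N + min (rowExit ty N h) 1 := by
  cases ty with
  | G => exact RowG.occCount_eq H le_rfl
  | D =>
    have h1 : RowD N h v w := H
    have h2 := h1.occCount_eq le_rfl
    rw [h1.1] at h2
    simpa [rowExit] using h2

theorem TypedRow.unique {ty : GD} {N : ℕ} {h v w h' v' w' : ℕ → ℕ} (H : TypedRow ty N h v w)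
    (H' : TypedRow ty N h' v' w') (hv : ∀ p < N, v p = v' p)
    (hw : ∀ p < N, w p = 0 ↔ w' p = 0) :
    (∀ p < N, w p = w' p) ∧ rowExit ty N h = rowExit ty N h' := by
  cases ty with
  | G => exact RowG.unique H H' hv hw
  | D => exact RowD.unique H H' hv hw

theorem TypedRow.congr_top {ty : GD} {N : ℕ} {h v w v' : ℕ → ℕ} (H : TypedRow ty N h v w)
    (hv : ∀ p < N, v p = v' p) : TypedRow ty N h v' w := by
  cases ty with
  | G => exact ⟨H.1, fun p hp => hv p hp ▸ H.2 p hp⟩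
  | D => exact ⟨H.1, fun p hp => hv p hp ▸ H.2 p hp⟩

theorem exitColor_eq_rowExit {m r N : ℕ} (Θ : Fin r → GD) (s : CState m r N) (t : Fin r) :
    exitColor m r N Θ s t = rowExit (Θ t) N (horN s t) := by
  unfold exitColor rowExit
  cases Θ t <;> simp [horN, Fin.last]

section Sys

variable {K : Type*} [Field K] {m r N : ℕ} {γ lam : Fin r → ℕ} {Θ : Fin r → GD} {z : Fin r → K}
  {s : CState m r N}

theorem Sys.typedRow (hs : Sys m r N γ lam Θ z s) (t : Fin r) :
    TypedRow (Θ t) N (horN s t) (verN s t) (verN s (t + 1)) := by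
  have hv : ∀ p (hp : p < N), wtVert (Θ t) (z t) (horN s t p) (verN s t p) (horN s t (p + 1))
      (verN s (t + 1) p) ≠ 0 := by
    intro p hp
    have h1 : wtVert (Θ t) (z t) (s.hor t ⟨p, by omega⟩ : ℕ) (s.ver ⟨t, by omega⟩ ⟨p, hp⟩ : ℕ)
      (s.hor t ⟨p + 1, by omega⟩ : ℕ) (s.ver ⟨t + 1, by omega⟩ ⟨p, hp⟩ : ℕ) ≠ 0 := hs.2 t ⟨p, hp⟩
    have h2 : (t : ℕ) < r + 1 := by omega
    have h3 : p < N + 1 := by omega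
    simpa [horN, verN, hp, h2, h3] using h1
  have hbd := hs.1.2.2.2 t
  cases hty : Θ t with
  | G =>
    rw [hty] at hv
    refine ⟨?_, fun p hp => vertG_of_wtG_ne_zero (hv p hp)⟩
    have := hbd.1 hty
    simp [horN, this]
  | D =>
    rw [hty] at hv
    refine ⟨?_, fun p hp => vertD_of_wtD_ne_zero (hv p hp)⟩
    have := hbd.2 hty
    simp only [Fin.last] at this
    simp [horN, this]

theorem Sys.verN_last (hs : Sys m r N γ lam Θ z s) {p : ℕ} (hp : p < N) : verN s r p = 0 := by
  have := hs.1.2.2.1 ⟨p, hp⟩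
  simp only [Fin.last] at this
  simp [verN, hp, this]

/-- Two states of systems with the same top boundary data have the same spins on top. -/
theorem Sys.verN_zero_eq {Θ' : Fin r → GD} {s' : CState m r N} (hs : Sys m r N γ lam Θ z s)
    (hs' : Sys m r N γ lam Θ' z s') {p : ℕ} (hp : p < N) : verN s 0 p = verN s' 0 p := by
  by_cases h : ∃ t : Fin r, colNum N ⟨p, hp⟩ = lam t + (r - 1 - (t : ℕ))
  · obtain ⟨t, ht⟩ := h
    have h1 := hs.1.2.1 ⟨p, hp⟩ t ht
    have h2 := hs'.1.2.1 ⟨p, hp⟩ t ht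
    simp [verN, hp, h1, h2]
  · have h0 : ∀ t : Fin r, colNum N ⟨p, hp⟩ ≠ lam t + (r - 1 - (t : ℕ)) :=
      fun t ht => h ⟨t, ht⟩
    have h1 := hs.1.1 ⟨p, hp⟩ h0
    have h2 := hs'.1.1 ⟨p, hp⟩ h0
    simp [verN, hp, h1, h2]

theorem Sys.le_occCount_zero (hs : Sys m r N γ lam Θ z s) (hγ : ∀ t, 1 ≤ γ t ∧ γ t ≤ m)
    (hmono : ∀ s t : Fin r, s ≤ t → lam t ≤ lam s)
    (hlamN : ∀ t : Fin r, lam t + (r - 1 - (t : ℕ)) < N) : r ≤ occCount (verN s 0) N := by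
  have hinj : Function.Injective fun t : Fin r => N - 1 - (lam t + (r - 1 - (t : ℕ))) := by
    intro t u h
    have h1 := hlamN t
    have h2 := hlamN u
    simp only at h
    rcases le_total t u with h3 | h3
    · have h4 := hmono t u h3
      have h5 : (t : ℕ) ≤ u := h3
      exact Fin.ext (by omega)
    · have h4 := hmono u t h3
      have h5 : (u : ℕ) ≤ t := h3
      exact Fin.ext (by omega)
  have hsub : Finset.univ.image (fun t : Fin r => N - 1 - (lam t + (r - 1 - (t : ℕ)))) ⊆
      (Finset.range N).filter (fun p => verN s 0 p ≠ 0) := by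
    intro p hp
    obtain ⟨t, -, rfl⟩ := Finset.mem_image.1 hp
    have h1 := hlamN t
    have hp : N - 1 - (lam t + (r - 1 - (t : ℕ))) < N := by omega
    have h2 := hs.1.2.1 ⟨_, hp⟩ t (by unfold colNum; simp only; omega)
    have h3 := (hγ t).1
    refine Finset.mem_filter.2 ⟨Finset.mem_range.2 hp, ?_⟩
    simp only [verN, Nat.zero_lt_succ, hp, and_self, dite_true]
    rw [show (⟨0, Nat.zero_lt_succ r⟩ : Fin (r + 1)) = 0 from rfl, h2]
    omega
  have hcard := Finset.card_le_card hsub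
  rw [Finset.card_image_of_injective _ hinj, Finset.card_univ, Fintype.card_fin,
    Finset.card_filter] at hcard
  refine hcard.trans (Finset.sum_le_sum fun p _ => ?_)
  split_ifs <;> omega

theorem Sys.occCount_verN (hs : Sys m r N γ lam Θ z s) (hγ : ∀ t, 1 ≤ γ t ∧ γ t ≤ m)
    (hmono : ∀ s t : Fin r, s ≤ t → lam t ≤ lam s)
    (hlamN : ∀ t : Fin r, lam t + (r - 1 - (t : ℕ)) < N) {l : ℕ} (hl : l ≤ r) :
    occCount (verN s l) N = r - l := by
  have hrow : ∀ l < r, occCount (verN s l) N ≤ occCount (verN s (l + 1)) N + 1 := by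
    intro l hl
    have := (hs.typedRow ⟨l, hl⟩).occCount_eq
    simp only at this
    omega
  have hlower : ∀ l ≤ r, r - l ≤ occCount (verN s l) N := by
    intro l
    induction l with
    | zero => exact fun _ => hs.le_occCount_zero hγ hmono hlamN
    | succ l ih =>
      intro hl
      have h1 := ih (by omega)
      have h2 := hrow l hl
      omega
  have hupper : occCount (verN s l) N ≤ r - l :=
    Nat.decreasingInduction' (P := fun l => occCount (verN s l) N ≤ r - l)
      (fun q hq _ h => by have := hrow q hq; omega) hl
      (by
        have h0 : occCount (verN s r) N = 0 :=
          Finset.sum_eq_zero fun p hp => by rw [hs.verN_last (Finset.mem_range.1 hp)]; rfl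
        omega)
  exact le_antisymm hupper (hlower l hl)

theorem Sys.rowExit_ne_zero (hs : Sys m r N γ lam Θ z s) (hγ : ∀ t, 1 ≤ γ t ∧ γ t ≤ m)
    (hmono : ∀ s t : Fin r, s ≤ t → lam t ≤ lam s)
    (hlamN : ∀ t : Fin r, lam t + (r - 1 - (t : ℕ)) < N) (t : Fin r) :
    rowExit (Θ t) N (horN s t) ≠ 0 := by
  have h1 := (hs.typedRow t).occCount_eq
  have h2 := hs.occCount_verN hγ hmono hlamN (l := t) (by omega)
  have h3 := hs.occCount_verN hγ hmono hlamN (l := t + 1) (by omega)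
  omega

end Sys

theorem eq_zero_iff_of_lists {N n : ℕ} {v v' x x' : ℕ → ℕ} (hx : Lists N n v x)
    (hx' : Lists N n v' x') (hn : occCount v N = n) (hn' : occCount v' N = n)
    (h : ∀ q < n, x q = x' q) {p : ℕ} (hp : p < N) : v p = 0 ↔ v' p = 0 := by
  refine eq_zero_iff_of_occCount_eq (fun c hc => ?_) hp
  have h1 := occCount_mono v hc
  have h2 := occCount_mono v' hc
  refine le_antisymm (le_of_forall_lt fun q hq => ?_) (le_of_forall_lt fun q hq => ?_)
  · rwa [← hx' q (by omega) c hc, ← h q (by omega), hx q (by omega) c hc]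
  · rwa [← hx q (by omega) c hc, h q (by omega), hx' q (by omega) c hc]

theorem bkEntry_eq {r i q : ℕ} (a : ℕ → ℕ → ℕ) (hi : 1 ≤ i) (hq : q < r - i) :
    bkEntry r a i (i + q) = bkSum (r - i) (fun q => a (i - 1) (i - 1 + q))
      (fun q => a (i + 1) (i + 1 + q)) q - a i (i + q) := by
  unfold bkEntry bkSum
  have h1 : i + q - 1 = i - 1 + q := by omega
  have h2 : i + q = i - 1 + (q + 1) := by omega
  have h3 : i + q + 1 = i + 1 + q := by omega
  have h4 : i + q = i ↔ q = 0 := by omega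
  have h5 : i + q = r - 1 ↔ q = r - i - 1 := by omega
  simp only [h4, h5, h1, h3]
  congr 2
  · split_ifs with h0
    · rw [h0]
    · rw [show i + 1 + (q - 1) = i + q by omega]
  · rw [show a (i - 1) (i + q) = a (i - 1) (i - 1 + (q + 1)) by rw [← h2]]

/-- Two consecutive rows of different types, compared with the two rows of the interchanged types
which have the same top spins, the same occupied bottom edges, and the middle level given by the
Berenstein–Kirillov involution. -/
theorem exchange_typedRows {ty ty' : GD} {N n : ℕ} {t e e' b b' f g f' g' x a a' w : ℕ → ℕ}
    (hne : ty ≠ ty') (hn : 1 ≤ n) (hf : TypedRow ty N f t e) (hg : TypedRow ty' N g e b)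
    (hf' : TypedRow ty' N f' t e') (hg' : TypedRow ty N g' e' b')
    (hf0 : rowExit ty N f ≠ 0) (hg0 : rowExit ty' N g ≠ 0) (hf0' : rowExit ty' N f' ≠ 0)
    (hg0' : rowExit ty N g' ≠ 0) (hb : ∀ p < N, b p = 0 ↔ b' p = 0)
    (hbN : occCount b N = n - 1) (hx : Lists N (n + 1) t x) (ha : Lists N n e a)
    (ha' : Lists N n e' a') (hw : Lists N (n - 1) b w)
    (hbk : ∀ q < n, a' q = bkSum n x w q - a q) :
    rowExit ty' N f' = rowExit ty' N g ∧ rowExit ty N g' = rowExit ty N f ∧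
      ∀ p < N, b p = b' p := by
  cases ty <;> cases ty'
  · exact absurd rfl hne
  · have hR := reflected_of_bkSum hn hf hg hf' hg' hg0 hf0' hb hbN hx ha ha' hw
      fun q hq => Or.inl (hbk q hq)
    obtain ⟨h1, h2, h3⟩ := exchange_rows hf hg hf' hg' hg0 hf0' hf0 hb hR
    exact ⟨h1.symm, h2.symm, h3⟩
  · have hb' : ∀ p < N, b' p = 0 ↔ b p = 0 := fun p hp => (hb p hp).symm
    have hw' : Lists N (n - 1) b' w := fun q hq c hc => by
      rw [occCount_congr hb' hc]
      exact hw q hq c hc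
    have hR := reflected_of_bkSum hn hf' hg' hf hg hg0' hf0 hb'
      ((occCount_congr hb' le_rfl).trans hbN) hx ha' ha hw' fun q hq => Or.inr (hbk q hq)
    obtain ⟨h1, h2, h3⟩ := exchange_rows hf' hg' hf hg hg0' hf0 hf0' hb' hR
    exact ⟨h2, h1, fun p hp => (h3 p hp).symm⟩
  · exact absurd rfl hne

theorem bkMap_of_ne {r i l : ℕ} (a : ℕ → ℕ → ℕ) (hl : l ≠ i) : bkMap r i a l = a l := by
  funext j
  exact if_neg fun h => hl h.1

theorem exitColor_of_bkMap {K : Type*} [Field K] {m r N : ℕ} {γ lam : Fin r → ℕ} {Θ : Fin r → GD}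
    {z : Fin r → K} {s s' : CState m r N} {u v : Fin r} (huv : (v : ℕ) = u + 1)
    (hΘ : Θ u ≠ Θ v) (hγ : ∀ t, 1 ≤ γ t ∧ γ t ≤ m)
    (hmono : ∀ s t : Fin r, s ≤ t → lam t ≤ lam s)
    (hlamN : ∀ t : Fin r, lam t + (r - 1 - (t : ℕ)) < N) (hs : Sys m r N γ lam Θ z s)
    (hs' : Sys m r N γ lam (Θ ∘ Equiv.swap u v) z s')
    (hiota : iotaArr m r N s' = bkMap r v (iotaArr m r N s)) (t : Fin r) :
    exitColor m r N (Θ ∘ Equiv.swap u v) s' t = exitColor m r N Θ s (Equiv.swap u v t) := by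
  have hc : ∀ l ≤ r, occCount (verN s l) N = r - l := fun l => hs.occCount_verN hγ hmono hlamN
  have hc' : ∀ l ≤ r, occCount (verN s' l) N = r - l := fun l => hs'.occCount_verN hγ hmono hlamN
  have hL : ∀ l, l < r → Lists N (r - l) (verN s l) (fun q => iotaArr m r N s l (l + q)) :=
    fun l hl => lists_iotaArr hl (hc l hl.le)
  have hL' : ∀ l, l < r → Lists N (r - l) (verN s' l) (fun q => iotaArr m r N s' l (l + q)) :=
    fun l hl => lists_iotaArr hl (hc' l hl.le)
  have hocc : ∀ l ≤ r, l ≠ v → ∀ p < N, verN s l p = 0 ↔ verN s' l p = 0 := by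
    intro l hl hlv p hp
    rcases hl.lt_or_eq with h | rfl
    · exact eq_zero_iff_of_lists (hL l h) (hL' l h) (hc l hl) (hc' l hl)
        (fun q _ => by simp only [hiota, bkMap_of_ne _ hlv]) hp
    · rw [hs.verN_last hp, hs'.verN_last hp]
  have hrow : ∀ t, t ≠ u → t ≠ v → (∀ p < N, verN s t p = verN s' t p) →
      (∀ p < N, verN s (t + 1) p = verN s' (t + 1) p) ∧
        rowExit (Θ t) N (horN s t) = rowExit (Θ t) N (horN s' t) := by
    intro t hu hv htop
    have h1 := hs'.typedRow t
    rw [Function.comp_apply, Equiv.swap_apply_of_ne_of_ne hu hv] at h1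
    have h2 : (t : ℕ) ≠ u := fun h => hu (Fin.ext h)
    exact (hs.typedRow t).unique h1 htop (hocc _ (by omega) (by omega))
  have hpair : (∀ p < N, verN s u p = verN s' u p) →
      rowExit (Θ v) N (horN s' u) = rowExit (Θ v) N (horN s v) ∧
      rowExit (Θ u) N (horN s' v) = rowExit (Θ u) N (horN s u) ∧
        ∀ p < N, verN s (v + 1) p = verN s' (v + 1) p := by
    intro htop
    have hvr := v.isLt
    have h1 := hs'.typedRow u
    have h2 := hs'.typedRow v
    have h3 := hs'.rowExit_ne_zero hγ hmono hlamN u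
    have h4 := hs'.rowExit_ne_zero hγ hmono hlamN v
    have h5 := hs.typedRow u
    rw [Function.comp_apply, Equiv.swap_apply_left] at h1 h3
    rw [Function.comp_apply, Equiv.swap_apply_right] at h2 h4
    rw [← huv] at h1 h5
    have hx := hL u u.isLt
    rw [show r - (u : ℕ) = r - v + 1 by omega] at hx
    have hw : Lists N (r - v - 1) (verN s (v + 1))
        (fun q => iotaArr m r N s (v + 1) (v + 1 + q)) := by
      rcases Nat.lt_or_ge (v + 1) r with h | h
      · exact hL (v + 1) h
      · intro q hq
        omega
    refine exchange_typedRows (n := r - v) hΘ (by omega) h5 (hs.typedRow v)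
      (h1.congr_top fun p hp => (htop p hp).symm) h2 (hs.rowExit_ne_zero hγ hmono hlamN u)
      (hs.rowExit_ne_zero hγ hmono hlamN v) h3 h4 (hocc _ (by omega) (by omega))
      (hc _ (by omega)) hx (hL v hvr) (hL' v hvr) hw fun q hq => ?_
    have h6 := bkEntry_eq (iotaArr m r N s) (show 1 ≤ (v : ℕ) by omega) hq
    rw [show (v : ℕ) - 1 = u by omega] at h6
    rw [← h6, hiota]
    exact if_pos (by omega)
  have hver : ∀ l ≤ r, l ≠ v → ∀ p < N, verN s l p = verN s' l p := by
    intro l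
    induction l using Nat.strong_induction_on with
    | _ l ih =>
      intro hl hlv
      rcases Nat.eq_zero_or_pos l with rfl | hpos
      · exact fun p hp => hs.verN_zero_eq hs' hp
      · by_cases h : l = v + 1
        · subst h
          exact (hpair (ih u (by omega) (by omega) (by omega))).2.2
        · have hlr : l - 1 < r := by omega
          have h1 := hrow ⟨l - 1, hlr⟩ (Fin.ne_of_val_ne (by simp only; omega))
            (Fin.ne_of_val_ne (by simp only; omega)) (ih (l - 1) (by omega) (by omega) (by omega))
          simpa only [Nat.sub_add_cancel hpos] using h1.1
  rw [exitColor_eq_rowExit, exitColor_eq_rowExit, Function.comp_apply]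
  have hp := hpair (hver u (by omega) (by omega))
  by_cases hu : t = u
  · subst hu
    rw [Equiv.swap_apply_left]
    exact hp.1
  by_cases hv : t = v
  · subst hv
    rw [Equiv.swap_apply_right]
    exact hp.2.1
  rw [Equiv.swap_apply_of_ne_of_ne hu hv]
  exact (hrow t hu hv (hver t t.isLt.le fun h => hv (Fin.ext h))).2.symm

/-- If `𝔰' ∈ 𝔖^{s_iΘ}_{λ+ρ}` corresponds to `𝔰 ∈ 𝔖^Θ_{λ+ρ}` under
the Berenstein–Kirillov involution `t_{r−i}`, then the exit boundary colors of `𝔰'` are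
those of `𝔰` with entries `i` and `i+1` interchanged. -/
theorem bk_boundary_colors (m r N : ℕ) (hm : 1 ≤ m) (hr : 1 ≤ r) (hN : 1 ≤ N)
    (K : Type*) [Field K] (z : Fin r → K) (hz : ∀ t, z t ≠ 0)
    (γ : Fin r → ℕ) (hγ : ∀ t, 1 ≤ γ t ∧ γ t ≤ m)
    (lam : Fin r → ℕ) (hmono : ∀ s t : Fin r, s ≤ t → lam t ≤ lam s)
    (hlamN : ∀ t : Fin r, lam t + (r - 1 - (t : ℕ)) < N)
    (Θ : Fin r → GD) (i : ℕ) (hi1 : 1 ≤ i) (hir : i < r)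
    (hΘ : Θ ⟨i - 1, by omega⟩ ≠ Θ ⟨i, hir⟩) :
    ∀ s s' : CState m r N, Sys (K := K) m r N γ lam Θ z s →
      Sys (K := K) m r N γ lam (Θ ∘ Equiv.swap (⟨i - 1, by omega⟩ : Fin r) ⟨i, hir⟩) z s' →
      iotaArr m r N s' = bkMap r i (iotaArr m r N s) →
      ∀ t : Fin r,
        exitColor m r N (Θ ∘ Equiv.swap (⟨i - 1, by omega⟩ : Fin r) ⟨i, hir⟩) s' t
          = exitColor m r N Θ s (Equiv.swap (⟨i - 1, by omega⟩ : Fin r) ⟨i, hir⟩ t) :=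
  fun _ _ hs hs' hiota => exitColor_of_bkMap (by simp only; omega) hΘ hγ hmono hlamN hs hs' hiota

end Crystal
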